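/- Let n, q, ℓ be positive integers. Let c : {1,…,n} → {1,…,q+ℓ} be uniformly random i.i.d. labels and let X = X(c) ⊆ E(K_n) be the random set of monochromatic pairs {u,v} (those with c(u) = c(v)). For β ⊆ α ⊆ E(K_n) define M_{βα} = Pr(α ∖ X = β), and define c_α = E_{Y ∼ MC(n,q)}[∏_{e ∈ α} Y_e]. Define ŵ recursively on subsets α of E(K_n) with 2|α| ≤ q+ℓ by: ŵ(∅) = 1 and ŵ(α) = c_α − Σ_{β ⊊ α} ŵ(β)·M_{βα}/M_{ββ} for α ≠ ∅ (all denominators M_{ββ} with β ⊆ α are positive since 2|β| ≤ q+ℓ). Then for every nonempty α ⊆ E(K_n) with 2|α| ≤ q+ℓ: |ŵ(α)| ≤ (sqrt(ℓ)/q)^{|V(α)|} · (|α|+1)^{|α|}. -/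

import Mathlib

open Finset

/-- Unordered pairs of distinct elements of `Fin n`, encoded as ordered pairs `(i,j)` with `i < j`. -/
abbrev Edge (n : ℕ) := {p : Fin n × Fin n // p.1 < p.2}

/-- Sample space for the planted multicoloring distribution `MC(n,q)`:
a uniformly random labeling of the vertices together with independent
uniform Rademacher variables, one for each edge. -/
abbrev MCSpace (n q : ℕ) := (Fin n → Fin q) × (Edge n → Bool)

/-- The observed sign vector `Y ∈ {-1,+1}^{E(K_n)}` of `MC(n,q)`: `Y_{ij} = +1`
if `i,j` have the same label, otherwise an independent uniform sign. -/
def mcY {n q : ℕ} (ω : MCSpace n q) (e : Edge n) : ℝ :=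
  if ω.1 e.val.1 = ω.1 e.val.2 then 1 else (if ω.2 e then 1 else -1)

/-- Expectation of `f(Y)` for `Y ∼ MC(n,q)` (the sample space is uniform). -/
noncomputable def mcExp (n q : ℕ) (f : (Edge n → ℝ) → ℝ) : ℝ :=
  (∑ ω : MCSpace n q, f (fun e => mcY ω e)) / (Fintype.card (MCSpace n q) : ℝ)

/-- Variance of `f(Y)` for `Y ∼ MC(n,q)`. -/
noncomputable def mcVar (n q : ℕ) (f : (Edge n → ℝ) → ℝ) : ℝ :=
  mcExp n q (fun Y => (f Y - mcExp n q f) ^ 2)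

/-- `V(α)`: the set of vertices incident to at least one pair of `α`. -/
def vertexSet {n : ℕ} (α : Finset (Edge n)) : Finset (Fin n) :=
  α.biUnion (fun e => {e.val.1, e.val.2})

open Classical in
noncomputable def prb (n k : ℕ) (A : (Fin n → Fin k) → Prop) : ℝ :=
  ((Finset.univ.filter A).card : ℝ) / (Fintype.card (Fin n → Fin k) : ℝ)

lemma prb_mul {n k : ℕ} (hk : 0 < k) (S : Finset (Fin n)) (A B : (Fin n → Fin k) → Prop)
    (hA : ∀ c c', (∀ v ∈ S, c v = c' v) → A c → A c')
    (hB : ∀ c c', (∀ v, v ∉ S → c v = c' v) → B c → B c') :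
    prb n k (fun c => A c ∧ B c) = prb n k A * prb n k B := by
  classical
  have hN : (0 : ℝ) < (Fintype.card (Fin n → Fin k) : ℝ) := by
    have : Nonempty (Fin k) := ⟨⟨0, hk⟩⟩
    exact_mod_cast Fintype.card_pos
  have key : (Finset.univ.filter (fun c => A c ∧ B c)).card * Fintype.card (Fin n → Fin k)
      = (Finset.univ.filter A).card * (Finset.univ.filter B).card := by
    rw [← Finset.card_univ, ← Finset.card_product, ← Finset.card_product]
    refine Finset.card_nbij' (fun p => (S.piecewise p.1 p.2, S.piecewise p.2 p.1))
      (fun p => (S.piecewise p.1 p.2, S.piecewise p.2 p.1)) ?_ ?_ ?_ ?_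
    · rintro ⟨c, c'⟩ h
      simp only [Finset.coe_product, Set.mem_prod, Finset.mem_coe, Finset.mem_filter,
        Finset.mem_univ, true_and, and_true] at h ⊢
      exact ⟨hA c _ (fun v hv => by simp [hv]) h.1, hB c _ (fun v hv => by simp [hv]) h.2⟩
    · rintro ⟨c, c'⟩ h
      simp only [Finset.coe_product, Set.mem_prod, Finset.mem_coe, Finset.mem_filter,
        Finset.mem_univ, true_and, and_true] at h ⊢
      exact ⟨hA c _ (fun v hv => by simp [hv]) h.1, hB c' _ (fun v hv => by simp [hv]) h.2⟩
    · rintro ⟨c, c'⟩ _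
      ext v <;> by_cases hv : v ∈ S <;> simp [hv]
    · rintro ⟨c, c'⟩ _
      ext v <;> by_cases hv : v ∈ S <;> simp [hv]
  have key' : ((Finset.univ.filter (fun c => A c ∧ B c)).card : ℝ) * (Fintype.card (Fin n → Fin k) : ℝ)
      = ((Finset.univ.filter A).card : ℝ) * ((Finset.univ.filter B).card : ℝ) := by
    exact_mod_cast key
  unfold prb
  rw [div_mul_div_comm, ← key']
  field_simp
  congr!

lemma card_compl_fun (n k : ℕ) (T : Finset (Fin n)) :
    Fintype.card ({v : Fin n // v ∉ T} → Fin k) * k ^ T.card = Fintype.card (Fin n → Fin k) := by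
  have h : T.card ≤ n := by simpa using Finset.card_le_univ T
  have h2 : Fintype.card {v : Fin n // v ∉ T} = n - T.card := by
    simp [Fintype.card_subtype_compl]
  rw [Fintype.card_fun, Fintype.card_fun, h2, Fintype.card_fin, Fintype.card_fin, ← pow_add,
    Nat.sub_add_cancel h]

lemma card_fun_pos {n k : ℕ} (hk : 0 < k) : (0 : ℝ) < (Fintype.card (Fin n → Fin k) : ℝ) := by
  have : Nonempty (Fin k) := ⟨⟨0, hk⟩⟩
  exact_mod_cast Fintype.card_pos

lemma prb_le_inj {n k : ℕ} (hk : 0 < k) (T : Finset (Fin n)) (A : (Fin n → Fin k) → Prop)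
    (h : ∀ c c', A c → A c' → (∀ v, v ∉ T → c v = c' v) → c = c') :
    prb n k A ≤ 1 / (k : ℝ) ^ T.card := by
  classical
  have hN := card_fun_pos (n := n) hk
  have h1 : (Finset.univ.filter A).card ≤ Fintype.card ({v : Fin n // v ∉ T} → Fin k) := by
    rw [← Finset.card_univ]
    refine Finset.card_le_card_of_injOn (fun c v => c v.1) (by simp) ?_
    intro c hc c' hc' hcc
    simp only [Finset.coe_filter, Set.mem_ofPred_eq, Finset.mem_univ, true_and] at hc hc'
    exact h c c' hc hc' (fun v hv => congrFun hcc ⟨v, hv⟩)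
  have h2 := card_compl_fun n k T
  have hk' : (0 : ℝ) < (k : ℝ) ^ T.card := by positivity
  unfold prb
  rw [div_le_div_iff₀ hN hk', one_mul]
  have h3 : (Finset.univ.filter A).card * k ^ T.card ≤ Fintype.card (Fin n → Fin k) := by
    rw [← h2]; gcongr
  exact_mod_cast h3

lemma prb_const {n k : ℕ} (hk : 0 < k) (V : Finset (Fin n)) (v0 : Fin n) (hv0 : v0 ∈ V) :
    prb n k (fun c => ∀ v ∈ V, c v = c v0) = 1 / (k : ℝ) ^ (V.card - 1) := by
  classical
  have hN := card_fun_pos (n := n) hk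
  set T := V.erase v0 with hT
  have hTc : T.card = V.card - 1 := Finset.card_erase_of_mem hv0
  have hv0T : v0 ∉ T := by simp [hT]
  have h1 : (Finset.univ.filter (fun c : Fin n → Fin k => ∀ v ∈ V, c v = c v0)).card
      = Fintype.card ({v : Fin n // v ∉ T} → Fin k) := by
    rw [← Finset.card_univ]
    refine Finset.card_nbij' (fun c v => c v.1)
      (fun d v => if h : v ∉ T then d ⟨v, h⟩ else d ⟨v0, hv0T⟩) ?_ ?_ ?_ ?_
    · intro c _; simp
    · intro d _
      simp only [Finset.coe_filter, Set.mem_ofPred_eq, Finset.mem_univ, true_and]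
      intro v hv
      by_cases hvT : v ∉ T
      · have : v = v0 := by
          by_contra hne
          exact hvT (by simp [hT, hne, hv])
        subst this; rfl
      · simp [hvT, hv0T]
    · intro c hc
      simp only [Finset.coe_filter, Set.mem_ofPred_eq, Finset.mem_univ, true_and] at hc
      ext v
      by_cases hvT : v ∈ T
      · have := hc v (Finset.mem_of_mem_erase hvT)
        simp [hvT, this]
      · simp [hvT]
    · intro d _
      ext v
      simp [v.2]
  have h2 := card_compl_fun n k T
  have hk' : (0 : ℝ) < (k : ℝ) ^ T.card := by positivity
  unfold prb
  rw [← hTc, div_eq_div_iff hN.ne' hk'.ne', one_mul]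
  have h3 : (Finset.univ.filter (fun c : Fin n → Fin k => ∀ v ∈ V, c v = c v0)).card * k ^ T.card
      = Fintype.card (Fin n → Fin k) := by rw [← h2, h1]
  have h4 := congrArg (Nat.cast : ℕ → ℝ) h3
  push_cast at h4 ⊢
  rw [← h4]
  congr!

lemma prb_mono {n k : ℕ} (A B : (Fin n → Fin k) → Prop) (h : ∀ c, A c → B c) :
    prb n k A ≤ prb n k B := by
  classical
  unfold prb
  refine div_le_div_of_nonneg_right ?_ (by positivity)
  exact_mod_cast Finset.card_le_card (Finset.monotone_filter_right _ (fun c _ hc => h c hc))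

lemma prb_nonneg {n k : ℕ} (A : (Fin n → Fin k) → Prop) : 0 ≤ prb n k A := by
  unfold prb; positivity

lemma prb_congr {n k : ℕ} (A B : (Fin n → Fin k) → Prop) (h : ∀ c, A c ↔ B c) :
    prb n k A = prb n k B := by
  rw [show A = B from funext fun c => propext (h c)]

lemma prb_mono_edge {n k : ℕ} (hk : 0 < k) (e : Edge n) :
    prb n k (fun c => c e.val.1 = c e.val.2) = 1 / k := by
  have h := prb_const hk ({e.val.1, e.val.2} : Finset (Fin n)) e.val.1 (by simp)
  rw [Finset.card_pair e.2.ne] at h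
  simp only [Nat.add_one_sub_one, pow_one] at h
  rw [← h]
  apply prb_congr
  intro c
  simp [eq_comm]

/-- probability that the bichromatic part of a is b -/
noncomputable def MM (n k : ℕ) (b a : Finset (Edge n)) : ℝ :=
  prb n k (fun c => a.filter (fun e => c e.val.1 ≠ c e.val.2) = b)

lemma MM_diag_ge {n k : ℕ} (hk : 0 < k) (b : Finset (Edge n)) :
    1 - (b.card : ℝ) / k ≤ MM n k b b := by
  classical
  have hN := card_fun_pos (n := n) hk
  have h1 : (Finset.univ : Finset (Fin n → Fin k)) ⊆
      (Finset.univ.filter (fun c : Fin n → Fin k => b.filter (fun e => c e.val.1 ≠ c e.val.2) = b)) ∪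
      b.biUnion (fun e => Finset.univ.filter (fun c : Fin n → Fin k => c e.val.1 = c e.val.2)) := by
    intro c _
    simp only [Finset.mem_union, Finset.mem_filter, Finset.mem_univ, true_and, Finset.mem_biUnion,
      Finset.filter_eq_self]
    by_contra! h
    obtain ⟨⟨e, he, h1⟩, h2⟩ := h
    exact h2 e he h1
  have h2 := (Finset.card_le_card h1).trans
    ((Finset.card_union_le _ _).trans (Nat.add_le_add_left Finset.card_biUnion_le _))
  have h3 : ((Fintype.card (Fin n → Fin k) : ℕ) : ℝ) ≤
     ((Finset.univ.filter (fun c : Fin n → Fin k => b.filter (fun e => c e.val.1 ≠ c e.val.2) = b)).card : ℝ)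
     + ∑ e ∈ b, ((Finset.univ.filter (fun c : Fin n → Fin k => c e.val.1 = c e.val.2)).card : ℝ) := by
    rw [Finset.card_univ] at h2
    exact_mod_cast h2
  have h4 : ∀ e ∈ b, ((Finset.univ.filter (fun c : Fin n → Fin k => c e.val.1 = c e.val.2)).card : ℝ)
      = (Fintype.card (Fin n → Fin k) : ℝ) * (1 / k) := by
    intro e _
    rw [← prb_mono_edge hk e]
    unfold prb
    rw [mul_div_cancel₀ _ hN.ne']
    congr!
  rw [Finset.sum_congr rfl h4, Finset.sum_const, nsmul_eq_mul] at h3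
  unfold MM prb
  rw [le_div_iff₀ hN]
  have : (1 - (b.card : ℝ) / k) * (Fintype.card (Fin n → Fin k) : ℝ) =
    (Fintype.card (Fin n → Fin k) : ℝ) - b.card * ((Fintype.card (Fin n → Fin k) : ℝ) * (1 / k)) := by ring
  rw [this]
  have h5 : ((Finset.univ.filter (fun c : Fin n → Fin k => b.filter (fun e => c e.val.1 ≠ c e.val.2) = b)).card : ℝ)
   = ((@Finset.filter _ (fun c : Fin n → Fin k => b.filter (fun e => c e.val.1 ≠ c e.val.2) = b) (fun _ => Classical.propDecidable _) Finset.univ).card : ℝ) := by congr!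
  rw [← h5]
  linarith

/-- probability that a is all monochromatic -/
noncomputable def CC (n k : ℕ) (a : Finset (Edge n)) : ℝ :=
  prb n k (fun c => ∀ e ∈ a, c e.val.1 = c e.val.2)

lemma mcExp_eq {n q : ℕ} (a : Finset (Edge n)) :
    mcExp n q (fun Y => ∏ e ∈ a, Y e) = CC n q a := by
  classical
  have h1 : ∀ c : Fin n → Fin q, ∑ s : Edge n → Bool, ∏ e ∈ a, mcY (c, s) e
      = if (∀ e ∈ a, c e.val.1 = c e.val.2) then (Fintype.card (Edge n → Bool) : ℝ) else 0 := by
    intro c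
    let f : Edge n → Bool → ℝ := fun e b =>
      if e ∈ a then (if c e.val.1 = c e.val.2 then 1 else (if b then 1 else -1)) else 1
    have h2 : ∀ s : Edge n → Bool, ∏ e ∈ a, mcY (c, s) e = ∏ e, f e (s e) := by
      intro s
      simp only [f, mcY]
      rw [Finset.prod_ite_mem, Finset.univ_inter]
    rw [Finset.sum_congr rfl (fun s _ => h2 s)]
    split_ifs with h
    · have : ∀ s : Edge n → Bool, ∏ e, f e (s e) = 1 := by
        intro s
        apply Finset.prod_eq_one
        intro e _
        by_cases he : e ∈ a
        · simp [f, he, h e he]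
        · simp [f, he]
      simp [this]
    · push Not at h
      obtain ⟨e, he, hne⟩ := h
      have := Finset.prod_univ_sum (fun _ : Edge n => (Finset.univ : Finset Bool)) f
      rw [Fintype.piFinset_univ] at this
      rw [← this]
      apply Finset.prod_eq_zero (Finset.mem_univ e)
      simp [f, he, hne]
  have hB : (0 : ℝ) < (Fintype.card (Edge n → Bool) : ℝ) := by exact_mod_cast Fintype.card_pos
  unfold mcExp CC prb
  rw [Fintype.sum_prod_type, Finset.sum_congr rfl (fun c _ => h1 c), Fintype.card_prod,
    ← Finset.sum_filter, Finset.sum_const, nsmul_eq_mul, Nat.cast_mul,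
    mul_div_mul_right _ _ hB.ne']
  congr!

lemma mem_vs {n : ℕ} {a : Finset (Edge n)} {e : Edge n} (he : e ∈ a) :
    e.val.1 ∈ vertexSet a ∧ e.val.2 ∈ vertexSet a := by
  unfold vertexSet
  simp only [Finset.mem_biUnion]
  exact ⟨⟨e, he, by simp⟩, ⟨e, he, by simp⟩⟩

lemma vs_mem {n : ℕ} {a : Finset (Edge n)} {v : Fin n} (hv : v ∈ vertexSet a) :
    ∃ e ∈ a, v = e.val.1 ∨ v = e.val.2 := by
  unfold vertexSet at hv
  simpa only [Finset.mem_biUnion, Finset.mem_insert, Finset.mem_singleton] using hv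

lemma vs_card_le {n : ℕ} (a : Finset (Edge n)) : (vertexSet a).card ≤ 2 * a.card := by
  unfold vertexSet
  rw [mul_comm]
  exact Finset.card_biUnion_le_card_mul _ _ _ (fun e _ => Finset.card_le_two)

lemma vs_mono {n : ℕ} {a b : Finset (Edge n)} (h : b ⊆ a) : vertexSet b ⊆ vertexSet a := by
  unfold vertexSet
  exact Finset.biUnion_subset_biUnion_of_subset_left _ h

lemma vs_union {n : ℕ} (a b : Finset (Edge n)) :
    vertexSet (a ∪ b) = vertexSet a ∪ vertexSet b := by
  unfold vertexSet
  exact Finset.union_biUnion ..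

lemma CC_mul {n k : ℕ} (hk : 0 < k) (a1 a2 : Finset (Edge n))
    (hd : Disjoint (vertexSet a1) (vertexSet a2)) :
    CC n k (a1 ∪ a2) = CC n k a1 * CC n k a2 := by
  unfold CC
  rw [← prb_mul hk (vertexSet a1)]
  · apply prb_congr
    intro c
    simp only [Finset.mem_union, or_imp, forall_and]
  · intro c c' h hA e he
    rw [← h _ (mem_vs he).1, ← h _ (mem_vs he).2]
    exact hA e he
  · intro c c' h hA e he
    rw [← h _ (Finset.disjoint_right.1 hd (mem_vs he).1),
      ← h _ (Finset.disjoint_right.1 hd (mem_vs he).2)]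
    exact hA e he

lemma edge_disj {n : ℕ} {a1 a2 : Finset (Edge n)}
    (hd : Disjoint (vertexSet a1) (vertexSet a2)) : Disjoint a1 a2 := by
  rw [Finset.disjoint_left]
  intro e h1 h2
  exact Finset.disjoint_left.1 hd (mem_vs h1).1 (mem_vs h2).1

lemma MM_mul {n k : ℕ} (hk : 0 < k) (a1 a2 b1 b2 : Finset (Edge n))
    (hd : Disjoint (vertexSet a1) (vertexSet a2)) (h1 : b1 ⊆ a1) (h2 : b2 ⊆ a2) :
    MM n k (b1 ∪ b2) (a1 ∪ a2) = MM n k b1 a1 * MM n k b2 a2 := by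
  have he := edge_disj hd
  unfold MM
  rw [← prb_mul hk (vertexSet a1)]
  · apply prb_congr
    intro c
    simp only [Finset.ext_iff, Finset.mem_filter, Finset.mem_union]
    constructor
    · intro h
      constructor
      · intro e
        have := h e
        have := @h1 e
        have := @h2 e
        have : e ∈ a1 → e ∉ a2 := fun hx => Finset.disjoint_left.1 he hx
        tauto
      · intro e
        have := h e
        have := @h1 e
        have := @h2 e
        have : e ∈ a1 → e ∉ a2 := fun hx => Finset.disjoint_left.1 he hx
        tauto
    · rintro ⟨h3, h4⟩ e
      rw [← h3 e, ← h4 e]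
      tauto
  · intro c c' h hA
    rw [← hA]
    apply Finset.filter_congr
    intro e he
    rw [← h _ (mem_vs he).1, ← h _ (mem_vs he).2]
  · intro c c' h hA
    rw [← hA]
    apply Finset.filter_congr
    intro e he
    rw [← h _ (Finset.disjoint_right.1 hd (mem_vs he).1),
      ← h _ (Finset.disjoint_right.1 hd (mem_vs he).2)]

/-- connectedness: no nontrivial splitting into vertex-disjoint parts -/
def Conn {n : ℕ} (a : Finset (Edge n)) : Prop :=
  ∀ a1 a2 : Finset (Edge n), a1 ∪ a2 = a → Disjoint (vertexSet a1) (vertexSet a2) →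
    a1 = ∅ ∨ a2 = ∅

lemma conn_pred {n : ℕ} {a : Finset (Edge n)} (ha : Conn a) (P : Fin n → Prop)
    (hP : ∀ e ∈ a, (P e.val.1 ↔ P e.val.2)) :
    (∀ v ∈ vertexSet a, P v) ∨ (∀ v ∈ vertexSet a, ¬ P v) := by
  classical
  have key := ha (a.filter (fun e => P e.val.1)) (a.filter (fun e => ¬ P e.val.1))
    (Finset.filter_union_filter_not_eq _ _) ?_
  · rcases key with h | h
    · right
      intro v hv
      obtain ⟨e, he, hve⟩ := vs_mem hv
      have h1 := (Finset.filter_eq_empty_iff.1 h) he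
      rcases hve with rfl | rfl
      · exact h1
      · rwa [← hP e he]
    · left
      intro v hv
      obtain ⟨e, he, hve⟩ := vs_mem hv
      have h1 := not_not.1 ((Finset.filter_eq_empty_iff.1 h) he)
      rcases hve with rfl | rfl
      · exact h1
      · rwa [← hP e he]
  · rw [Finset.disjoint_left]
    intro v h1 h2
    obtain ⟨e, he, hve⟩ := vs_mem h1
    obtain ⟨f, hf, hvf⟩ := vs_mem h2
    rw [Finset.mem_filter] at he hf
    have e1 := hP e he.1
    have f1 := hP f hf.1
    have : P v := by
      rcases hve with rfl | rfl
      · exact he.2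
      · exact e1.1 he.2
    have : ¬ P v := by
      rcases hvf with rfl | rfl
      · exact hf.2
      · rw [← f1]; exact hf.2
    contradiction

lemma CC_conn {n k : ℕ} (hk : 0 < k) {a : Finset (Edge n)} (ha : Conn a) (hne : a.Nonempty) :
    CC n k a = 1 / (k : ℝ) ^ ((vertexSet a).card - 1) := by
  obtain ⟨e0, he0⟩ := hne
  rw [← prb_const hk (vertexSet a) e0.val.1 (mem_vs he0).1]
  apply prb_congr
  intro c
  constructor
  · intro h
    rcases conn_pred ha (fun v => c v = c e0.val.1) (fun e he => by rw [h e he]) with h1 | h1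
    · exact h1
    · exact absurd rfl (h1 _ (mem_vs he0).1)
  · intro h e he
    rw [h _ (mem_vs he).1, h _ (mem_vs he).2]

lemma MM_empty {n k : ℕ} (a : Finset (Edge n)) : MM n k ∅ a = CC n k a := by
  apply prb_congr
  intro c
  simp [Finset.filter_eq_empty_iff]

lemma CC_empty {n k : ℕ} (hk : 0 < k) : CC n k ∅ = 1 := by
  have := card_fun_pos (n := n) hk
  unfold CC prb
  simp only [Finset.notMem_empty, false_imp_iff, implies_true, Finset.filter_true,
    Finset.card_univ]
  exact div_self this.ne'

lemma MM_le {n k : ℕ} (hk : 0 < k) {a b : Finset (Edge n)} (ha : Conn a) (hb : b.Nonempty)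
    (hba : b ⊆ a) :
    MM n k b a ≤ 1 / (k : ℝ) ^ ((vertexSet a).card - (vertexSet b).card) := by
  rw [← Finset.card_sdiff_of_subset (vs_mono hba)]
  apply prb_le_inj hk
  intro c c' hc hc' h
  have hm : ∀ d : Fin n → Fin k, a.filter (fun e => d e.val.1 ≠ d e.val.2) = b →
      ∀ e ∈ a, e ∉ b → d e.val.1 = d e.val.2 := by
    intro d hd e he heb
    by_contra hne
    exact heb (hd ▸ Finset.mem_filter.2 ⟨he, hne⟩)
  have hVb : ∀ v ∈ vertexSet b, c v = c' v := fun v hv => h v (by simp [hv])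
  obtain ⟨e0, he0⟩ := hb
  have hp := conn_pred ha (fun v => c v = c' v) (fun e he => by
    by_cases heb : e ∈ b
    · simp [hVb _ (mem_vs heb).1, hVb _ (mem_vs heb).2]
    · rw [hm c hc e he heb, hm c' hc' e he heb])
  rcases hp with h1 | h1
  · funext v
    by_cases hv : v ∈ vertexSet a
    · exact h1 v hv
    · exact h v (by simp [hv])
  · exact absurd (hVb _ (mem_vs he0).1) (h1 _ (mem_vs (hba he0)).1)

lemma w_mul {n k : ℕ} (hk : 0 < k) (C : Finset (Edge n) → ℝ) (w : Finset (Edge n) → ℝ)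
    (hC : ∀ a1 a2, Disjoint (vertexSet a1) (vertexSet a2) → C (a1 ∪ a2) = C a1 * C a2)
    (hpos : ∀ b : Finset (Edge n), 2 * b.card ≤ k → 0 < MM n k b b)
    (hw : ∀ a : Finset (Edge n), 2 * a.card ≤ k →
      C a = ∑ b ∈ a.powerset, w b * MM n k b a / MM n k b b) :
    ∀ m : ℕ, ∀ a1 a2 : Finset (Edge n), (a1 ∪ a2).card = m → 2 * (a1 ∪ a2).card ≤ k →
      Disjoint (vertexSet a1) (vertexSet a2) → w (a1 ∪ a2) = w a1 * w a2 := by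
  intro m
  induction m using Nat.strong_induction_on with
  | _ m ih =>
  intro a1 a2 hm hmk hd
  have he := edge_disj hd
  have hk1 : 2 * a1.card ≤ k :=
    le_trans (Nat.mul_le_mul_left _ (Finset.card_le_card Finset.subset_union_left)) hmk
  have hk2 : 2 * a2.card ≤ k :=
    le_trans (Nat.mul_le_mul_left _ (Finset.card_le_card Finset.subset_union_right)) hmk
  have e1 := hw _ hmk
  rw [hC _ _ hd, hw _ hk1, hw _ hk2, Finset.sum_mul_sum, ← Finset.sum_product'] at e1
  have e2 : ∑ x ∈ a1.powerset ×ˢ a2.powerset,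
      w x.1 * MM n k x.1 a1 / MM n k x.1 x.1 * (w x.2 * MM n k x.2 a2 / MM n k x.2 x.2)
      = ∑ b ∈ (a1 ∪ a2).powerset,
        (w (b ∩ a1) * w (b ∩ a2)) * MM n k b (a1 ∪ a2) / MM n k b b := by
    have hleft : ∀ b1 b2, b1 ⊆ a1 → b2 ⊆ a2 → (b1 ∪ b2) ∩ a1 = b1 := by
      intro b1 b2 h1 h2
      ext e
      have := @h1 e
      have := @h2 e
      have : e ∈ a1 → e ∉ a2 := fun hx => Finset.disjoint_left.1 he hx
      simp only [Finset.mem_inter, Finset.mem_union]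
      tauto
    have hright : ∀ b1 b2, b1 ⊆ a1 → b2 ⊆ a2 → (b1 ∪ b2) ∩ a2 = b2 := by
      intro b1 b2 h1 h2
      ext e
      have := @h1 e
      have := @h2 e
      have : e ∈ a1 → e ∉ a2 := fun hx => Finset.disjoint_left.1 he hx
      simp only [Finset.mem_inter, Finset.mem_union]
      tauto
    refine Finset.sum_nbij' (fun x => x.1 ∪ x.2) (fun b => (b ∩ a1, b ∩ a2)) ?_ ?_ ?_ ?_ ?_
    · rintro ⟨b1, b2⟩ h
      simp only [Finset.mem_product, Finset.mem_powerset] at h ⊢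
      exact Finset.union_subset_union h.1 h.2
    · intro b _
      simp
    · rintro ⟨b1, b2⟩ h
      simp only [Finset.mem_product, Finset.mem_powerset] at h
      simp only [hleft b1 b2 h.1 h.2, hright b1 b2 h.1 h.2]
    · intro b hb
      simp only [Finset.mem_powerset] at hb
      simp only
      rw [← Finset.inter_union_distrib_left, Finset.inter_eq_left.2 hb]
    · rintro ⟨b1, b2⟩ h
      simp only [Finset.mem_product, Finset.mem_powerset] at h
      simp only [hleft b1 b2 h.1 h.2, hright b1 b2 h.1 h.2]
      rw [MM_mul hk a1 a2 b1 b2 hd h.1 h.2,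
        MM_mul hk b1 b2 b1 b2 (hd.mono (vs_mono h.1) (vs_mono h.2)) subset_rfl subset_rfl]
      rw [div_mul_div_comm]
      congr 1
      ring
  rw [e2] at e1
  have hmem : a1 ∪ a2 ∈ (a1 ∪ a2).powerset := Finset.mem_powerset_self _
  rw [← Finset.add_sum_erase _ _ hmem, ← Finset.add_sum_erase _ _ hmem] at e1
  have e3 : ∑ b ∈ (a1 ∪ a2).powerset.erase (a1 ∪ a2),
        (w (b ∩ a1) * w (b ∩ a2)) * MM n k b (a1 ∪ a2) / MM n k b b
      = ∑ b ∈ (a1 ∪ a2).powerset.erase (a1 ∪ a2), w b * MM n k b (a1 ∪ a2) / MM n k b b := by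
    apply Finset.sum_congr rfl
    intro b hb
    rw [Finset.mem_erase, Finset.mem_powerset] at hb
    have hb' : b ∩ a1 ∪ b ∩ a2 = b := by
      rw [← Finset.inter_union_distrib_left, Finset.inter_eq_left.2 hb.2]
    have hlt : b.card < (a1 ∪ a2).card :=
      Finset.card_lt_card (Finset.ssubset_iff_subset_ne.2 ⟨hb.2, hb.1⟩)
    have := ih b.card (hm ▸ hlt) (b ∩ a1) (b ∩ a2) (by rw [hb']) (by rw [hb']; omega)
      (hd.mono (vs_mono Finset.inter_subset_right) (vs_mono Finset.inter_subset_right))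
    rw [hb'] at this
    rw [this]
  rw [e3] at e1
  have e4 := add_right_cancel e1
  have hp := hpos _ hmk
  rw [mul_div_cancel_right₀ _ hp.ne', mul_div_cancel_right₀ _ hp.ne'] at e4
  rw [← e4, Finset.union_inter_cancel_left, Finset.union_inter_cancel_right]

/-- the weights used in the numeric estimate -/
noncomputable def ff (m j : ℕ) : ℝ :=
  if j = 0 then 2 * m - 1 else if j = m then 0 else
    ((j : ℝ) + 1) ^ j * (2 * m / (2 * m - j))

lemma numeric (m : ℕ) (hm : 1 ≤ m) :
    ∑ j ∈ Finset.range (m + 1), (m.choose j : ℝ) * ff m j ≤ ((m : ℝ) + 1) ^ m := by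
  rcases Nat.lt_or_ge m 2 with h | h
  · have : m = 1 := by omega
    subst this
    norm_num [Finset.sum_range_succ, ff]
  obtain ⟨p, rfl⟩ : ∃ p, m = p + 2 := ⟨m - 2, by omega⟩
  rw [add_pow]
  simp only [one_pow, mul_one]
  rw [Finset.sum_range_succ, Finset.sum_range_succ, Finset.sum_range_succ',
    Finset.sum_range_succ _ (p + 2), Finset.sum_range_succ _ (p + 1), Finset.sum_range_succ']
  have hmid : ∑ j ∈ Finset.range p, ((p + 2).choose (j + 1) : ℝ) * ff (p + 2) (j + 1) ≤
      ∑ j ∈ Finset.range p, (((p + 2 : ℕ) : ℝ)) ^ (j + 1) * ((p + 2).choose (j + 1) : ℝ) := by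
    apply Finset.sum_le_sum
    intro j hj
    rw [Finset.mem_range] at hj
    rw [mul_comm]
    gcongr
    unfold ff
    rw [if_neg (by omega), if_neg (by omega)]
    obtain ⟨i, rfl⟩ : ∃ i, p = j + 1 + i := ⟨p - (j + 1), by omega⟩
    push_cast
    have hj0 : (0 : ℝ) ≤ j := by positivity
    have hi0 : (0 : ℝ) ≤ i := by positivity
    have hb := one_add_mul_le_pow (a := ((i : ℝ) + 1) / (j + 2)) (by
      have : (0 : ℝ) ≤ ((i : ℝ) + 1) / (j + 2) := by positivity
      linarith) (j + 1)
    have h1 : (1 : ℝ) + ((i : ℝ) + 1) / (j + 2) = ((j : ℝ) + 1 + i + 2) / (j + 2) := by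
      field_simp; ring
    rw [h1, div_pow, le_div_iff₀ (by positivity)] at hb
    refine le_trans ?_ hb
    rw [show (j : ℝ) + 1 + 1 = j + 2 by ring, mul_comm]
    gcongr
    have h2 : (0 : ℝ) < 2 * ((j : ℝ) + 1 + i + 2) - (j + 1) := by linarith
    rw [div_le_iff₀ h2]
    push_cast
    have h3 : (1 + ((j : ℝ) + 1) * (((i : ℝ) + 1) / (j + 2))) =
      ((j + 2) + (j + 1) * (i + 1)) / (j + 2) := by field_simp
    rw [h3, div_mul_eq_mul_div, le_div_iff₀ (by positivity)]
    nlinarith [mul_nonneg hj0 hi0, mul_nonneg (mul_nonneg hj0 hi0) hi0, mul_nonneg (mul_nonneg hj0 hj0) hi0, mul_nonneg hj0 hj0, mul_nonneg hi0 hi0]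
  have h0 : ff (p + 2) 0 = 2 * (p + 2) - 1 := by simp [ff]
  have hl : ff (p + 2) (p + 2) = 0 := by simp [ff]
  have hl1 : ff (p + 2) (p + 1) = ((p : ℝ) + 2) ^ (p + 1) * (2 * (p + 2) / (p + 3)) := by
    unfold ff
    rw [if_neg (by omega), if_neg (by omega)]
    push_cast
    congr 2 <;> ring
  have hc : (p + 2).choose (p + 1) = p + 2 := by
    simp
  rw [h0, hl, hl1, hc]
  simp only [Nat.choose_zero_right, Nat.choose_self, Nat.cast_one, mul_one, one_mul, mul_zero,
    add_zero, pow_zero]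
  push_cast at hmid ⊢
  have hp0 : (0 : ℝ) ≤ p := by positivity
  have hpow : ((p : ℝ) + 2) ^ 2 ≤ ((p : ℝ) + 2) ^ (p + 2) :=
    pow_le_pow_right₀ (by linarith) (by omega)
  have e1 : ((p : ℝ) + 2) * (((p : ℝ) + 2) ^ (p + 1) * (2 * (p + 2) / (p + 3))) =
     2 * ((p : ℝ) + 2) ^ (p + 2) - 2 * (((p : ℝ) + 2) ^ (p + 2) / (p + 3)) := by
    field_simp; ring
  have e2 : ((p : ℝ) + 2) ^ (p + 1) * ((p : ℝ) + 2) = ((p : ℝ) + 2) ^ (p + 2) := by ring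
  have e3 : ((p : ℝ) + 1) ≤ ((p : ℝ) + 2) ^ (p + 2) / (p + 3) := by
    rw [le_div_iff₀ (by positivity)]; nlinarith
  rw [e1, e2]
  linarith

lemma diff_bound (q ℓ v : ℕ) (hq : 1 ≤ q) (hℓ : 1 ≤ ℓ) (hv : 2 ≤ v) :
    |1 / (q : ℝ) ^ (v - 1) - 1 / ((q + ℓ : ℕ) : ℝ) ^ (v - 1)| ≤
      (Real.sqrt ℓ / q) ^ v * (v - 1) := by
  obtain ⟨d, rfl⟩ : ∃ d, v = d + 1 := ⟨v - 1, by omega⟩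
  have hq' : (1 : ℝ) ≤ q := by exact_mod_cast hq
  have hl' : (1 : ℝ) ≤ ℓ := by exact_mod_cast hℓ
  simp only [Nat.add_sub_cancel]
  push_cast
  have h1 : 1 / ((q : ℝ) + ℓ) ^ d ≤ 1 / (q : ℝ) ^ d := by
    gcongr; linarith
  rw [abs_of_nonneg (by linarith)]
  have hb := one_add_mul_le_pow (a := (q : ℝ) / (q + ℓ) - 1) (by
      have : (0 : ℝ) ≤ (q : ℝ) / (q + ℓ) := by positivity
      linarith) d
  rw [add_sub_cancel] at hb
  have h2 : 1 / (q : ℝ) ^ d - 1 / ((q : ℝ) + ℓ) ^ d = (1 / (q : ℝ) ^ d) * (1 - ((q : ℝ) / (q + ℓ)) ^ d) := by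
    rw [div_pow]; field_simp
  have h3 : 1 - ((q : ℝ) / (q + ℓ)) ^ d ≤ d * (ℓ / (q + ℓ)) := by
    have : (q : ℝ) / (q + ℓ) - 1 = - (ℓ / (q + ℓ)) := by field_simp; ring
    rw [this] at hb
    linarith
  have h4 : (ℓ : ℝ) / (q + ℓ) ≤ ℓ / q := by gcongr; linarith
  have h5 : (ℓ : ℝ) ≤ Real.sqrt ℓ ^ (d + 1) := by
    calc (ℓ : ℝ) = Real.sqrt ℓ ^ 2 := (Real.sq_sqrt (by positivity)).symm
      _ ≤ _ := pow_le_pow_right₀ (by rw [Real.one_le_sqrt]; exact hl') hv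
  rw [h2, div_pow (Real.sqrt _)]
  calc (1 / (q : ℝ) ^ d) * (1 - ((q : ℝ) / (q + ℓ)) ^ d) ≤ (1 / (q : ℝ) ^ d) * (d * (ℓ / q)) := by
        gcongr
        exact h3.trans (by gcongr)
    _ = ℓ / (q : ℝ) ^ (d + 1) * d := by rw [pow_succ]; field_simp
    _ ≤ _ := by
      rw [add_sub_cancel_right]
      gcongr

lemma two_le_vs {n : ℕ} {a : Finset (Edge n)} (ha : a.Nonempty) : 2 ≤ (vertexSet a).card := by
  obtain ⟨e, he⟩ := ha
  rw [← Finset.card_pair e.2.ne]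
  apply Finset.card_le_card
  intro v hv
  simp only [Finset.mem_insert, Finset.mem_singleton] at hv
  rcases hv with rfl | rfl
  · exact (mem_vs he).1
  · exact (mem_vs he).2

lemma conn_case {n q ℓ : ℕ} (hq : 1 ≤ q) (hℓ : 1 ≤ ℓ) (w : Finset (Edge n) → ℝ) (hw0 : w ∅ = 1)
    (a : Finset (Edge n)) (hne : a.Nonempty) (hc : Conn a) (hk : 2 * a.card ≤ q + ℓ)
    (hw : w a = CC n q a - ∑ b ∈ a.powerset.erase a, w b * MM n (q + ℓ) b a / MM n (q + ℓ) b b)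
    (ih : ∀ b ⊆ a, b ≠ a → b.Nonempty → |w b| ≤
      (Real.sqrt (ℓ : ℝ) / (q : ℝ)) ^ (vertexSet b).card * ((b.card : ℝ) + 1) ^ b.card) :
    |w a| ≤ (Real.sqrt (ℓ : ℝ) / (q : ℝ)) ^ (vertexSet a).card *
        ((a.card : ℝ) + 1) ^ a.card := by
  have hkp : 0 < q + ℓ := by omega
  have hq' : (1 : ℝ) ≤ q := by exact_mod_cast hq
  have hl' : (1 : ℝ) ≤ ℓ := by exact_mod_cast hℓ
  have hm1 : 1 ≤ a.card := hne.card_pos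
  set r := Real.sqrt (ℓ : ℝ) / (q : ℝ) with hr
  have hr0 : 0 ≤ r := by positivity
  have hrk : 1 / ((q + ℓ : ℕ) : ℝ) ≤ r := by
    have : (1 : ℝ) ≤ Real.sqrt ℓ := by rw [Real.one_le_sqrt]; exact hl'
    rw [hr]
    push_cast
    gcongr
    linarith
  set V := (vertexSet a).card with hV
  have hV2 : 2 ≤ V := two_le_vs hne
  have hVm : V ≤ 2 * a.card := vs_card_le a
  have hemp : ∅ ∈ a.powerset.erase a := by
    simp [hne.ne_empty.symm]
  rw [← Finset.add_sum_erase _ _ hemp, hw0, MM_empty, MM_empty, CC_empty hkp,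
    CC_conn hkp hc hne, CC_conn (by omega) hc hne, one_mul, div_one, ← sub_sub] at hw
  have hterm : ∀ b ∈ (a.powerset.erase a).erase ∅,
      |w b * MM n (q + ℓ) b a / MM n (q + ℓ) b b| ≤ r ^ V * ff a.card b.card := by
    intro b hb
    simp only [Finset.mem_erase, Finset.mem_powerset] at hb
    obtain ⟨hb0, hba, hsub⟩ := hb
    have hbne : b.Nonempty := Finset.nonempty_iff_ne_empty.2 hb0
    have hlt : b.card < a.card :=
      Finset.card_lt_card (Finset.ssubset_iff_subset_ne.2 ⟨hsub, hba⟩)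
    have hlt' : (b.card : ℝ) + 1 ≤ a.card := by exact_mod_cast hlt
    have hmpos : (1 : ℝ) ≤ a.card := by exact_mod_cast hm1
    have hbpos : 0 < b.card := hbne.card_pos
    have hff : ff a.card b.card =
        ((b.card : ℝ) + 1) ^ b.card * (2 * a.card / (2 * a.card - b.card)) := by
      unfold ff
      rw [if_neg (by omega), if_neg (by omega)]
    have hD : (2 * (a.card : ℝ) - b.card) / (2 * a.card) ≤ MM n (q + ℓ) b b := by
      refine le_trans ?_ (MM_diag_ge hkp b)
      have h1 : 2 * (a.card : ℝ) ≤ ((q + ℓ : ℕ) : ℝ) := by exact_mod_cast hk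
      rw [sub_div, div_self (by positivity)]
      gcongr
    have hDpos : 0 < (2 * (a.card : ℝ) - b.card) / (2 * a.card) := by
      apply div_pos <;> linarith
    have hvle : (vertexSet b).card ≤ V := Finset.card_le_card (vs_mono hsub)
    have hN : MM n (q + ℓ) b a ≤ r ^ (V - (vertexSet b).card) := by
      refine (MM_le hkp hc hbne hsub).trans ?_
      rw [← one_div_pow]
      gcongr
    have hN0 : 0 ≤ MM n (q + ℓ) b a := prb_nonneg _
    rw [abs_div, abs_mul, abs_of_nonneg hN0, abs_of_pos (hDpos.trans_le hD), hff]
    calc |w b| * MM n (q + ℓ) b a / MM n (q + ℓ) b b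
        ≤ (r ^ (vertexSet b).card * ((b.card : ℝ) + 1) ^ b.card) * r ^ (V - (vertexSet b).card) /
          ((2 * (a.card : ℝ) - b.card) / (2 * a.card)) := by
          gcongr
          exact ih b hsub hba hbne
      _ = r ^ ((vertexSet b).card + (V - (vertexSet b).card)) * (((b.card : ℝ) + 1) ^ b.card *
          (2 * a.card / (2 * a.card - b.card))) := by
          rw [pow_add, div_div_eq_mul_div]; ring
      _ = _ := by rw [Nat.add_sub_cancel' hvle]
  have hfirst : |1 / (q : ℝ) ^ (V - 1) - 1 / ((q + ℓ : ℕ) : ℝ) ^ (V - 1)| ≤ r ^ V * ff a.card 0 := by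
    refine (diff_bound q ℓ V hq hℓ hV2).trans ?_
    rw [← hr]
    gcongr
    have : (V : ℝ) ≤ 2 * a.card := by exact_mod_cast hVm
    simp only [ff, if_true]
    linarith
  have hsum : ∑ b ∈ a.powerset, ff a.card b.card ≤ ((a.card : ℝ) + 1) ^ a.card := by
    rw [Finset.sum_powerset_apply_card (fun j => ff a.card j)]
    simp only [nsmul_eq_mul]
    exact numeric _ hm1
  rw [← Finset.add_sum_erase _ _ (Finset.mem_powerset_self a), ← Finset.add_sum_erase _ _ hemp] at hsum
  have hffm : ff a.card a.card = 0 := by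
    unfold ff
    rw [if_neg (by omega), if_pos rfl]
  rw [hffm, zero_add, Finset.card_empty] at hsum
  rw [hw]
  calc _ ≤ r ^ V * ff a.card 0 + ∑ b ∈ (a.powerset.erase a).erase ∅, r ^ V * ff a.card b.card := by
        refine (abs_sub _ _).trans (add_le_add hfirst ?_)
        exact (Finset.abs_sum_le_sum_abs _ _).trans (Finset.sum_le_sum hterm)
    _ = r ^ V * (ff a.card 0 + ∑ b ∈ (a.powerset.erase a).erase ∅, ff a.card b.card) := by
        rw [mul_add, Finset.mul_sum]
    _ ≤ _ := by gcongr

/-- Let `c : {1,…,n} → {1,…,q+ℓ}` be uniform i.i.d. labels and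
`X = X(c)` the set of monochromatic pairs, so that `α ∖ X` is the set of bichromatic
pairs of `α`, and `M_{βα} = Pr(α ∖ X = β)`. With `c_α = E_{MC(n,q)}[∏_{e∈α} Y_e]` and
`ŵ` defined by `ŵ(∅) = 1` and `ŵ(α) = c_α − ∑_{β ⊊ α} ŵ(β)·M_{βα}/M_{ββ}` for
nonempty `α` with `2|α| ≤ q+ℓ`, every such `α` satisfies
`|ŵ(α)| ≤ (√ℓ/q)^{|V(α)|}·(|α|+1)^{|α|}`. -/
theorem stmt13 (n q ℓ : ℕ) (hn : 1 ≤ n) (hq : 1 ≤ q) (hℓ : 1 ≤ ℓ)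
    (M : Finset (Edge n) → Finset (Edge n) → ℝ)
    (hM : ∀ β α : Finset (Edge n), M β α =
      ((Finset.univ.filter (fun c : Fin n → Fin (q + ℓ) =>
          α.filter (fun e => c e.val.1 ≠ c e.val.2) = β)).card : ℝ) /
        (Fintype.card (Fin n → Fin (q + ℓ)) : ℝ))
    (w : Finset (Edge n) → ℝ) (hw0 : w ∅ = 1)
    (hw : ∀ α : Finset (Edge n), α ≠ ∅ → 2 * α.card ≤ q + ℓ →
      w α = mcExp n q (fun Y => ∏ e ∈ α, Y e) -
        ∑ β ∈ α.powerset.erase α, w β * M β α / M β β) :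
    ∀ α : Finset (Edge n), α ≠ ∅ → 2 * α.card ≤ q + ℓ →
      |w α| ≤ (Real.sqrt (ℓ : ℝ) / (q : ℝ)) ^ (vertexSet α).card *
        ((α.card : ℝ) + 1) ^ α.card := by
  have hkp : 0 < q + ℓ := by omega
  have hM' : ∀ b a, M b a = MM n (q + ℓ) b a := by
    intro b a
    rw [hM]
    unfold MM prb
    congr!
  simp only [hM', mcExp_eq] at hw
  have hpos : ∀ b : Finset (Edge n), 2 * b.card ≤ q + ℓ → 0 < MM n (q + ℓ) b b := by
    intro b hb
    refine lt_of_lt_of_le ?_ (MM_diag_ge hkp b)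
    have h1 : 2 * (b.card : ℝ) ≤ ((q + ℓ : ℕ) : ℝ) := by exact_mod_cast hb
    have h2 : (0 : ℝ) < ((q + ℓ : ℕ) : ℝ) := by exact_mod_cast hkp
    rw [sub_pos, div_lt_one h2]
    linarith
  have hw' : ∀ a : Finset (Edge n), 2 * a.card ≤ q + ℓ →
      CC n q a = ∑ b ∈ a.powerset, w b * MM n (q + ℓ) b a / MM n (q + ℓ) b b := by
    intro a ha
    by_cases hne : a = ∅
    · subst hne
      simp [MM_empty, CC_empty hkp, CC_empty (show 0 < q by omega), hw0]
    · rw [← Finset.add_sum_erase _ _ (Finset.mem_powerset_self a), hw a hne ha,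
        mul_div_cancel_right₀ _ (hpos a ha).ne']
      ring
  have hmul := w_mul hkp (CC n q) w (CC_mul (by omega)) hpos hw'
  suffices H : ∀ m : ℕ, ∀ α : Finset (Edge n), α.card = m → α ≠ ∅ → 2 * α.card ≤ q + ℓ →
      |w α| ≤ (Real.sqrt (ℓ : ℝ) / (q : ℝ)) ^ (vertexSet α).card *
        ((α.card : ℝ) + 1) ^ α.card from fun α => H _ α rfl
  intro m
  induction m using Nat.strong_induction_on with
  | _ m ih =>
  intro a hm hne hk
  by_cases hc : Conn a
  · refine conn_case hq hℓ w hw0 a (Finset.nonempty_iff_ne_empty.2 hne) hc hk (hw a hne hk) ?_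
    intro b hsub hba hb
    have hlt : b.card < a.card :=
      Finset.card_lt_card (Finset.ssubset_iff_subset_ne.2 ⟨hsub, hba⟩)
    exact ih b.card (by omega) b rfl hb.ne_empty (by omega)
  · unfold Conn at hc
    push Not at hc
    obtain ⟨a1, a2, rfl, hd, h1, h2⟩ := hc
    have hcard := Finset.card_union_of_disjoint (edge_disj hd)
    have p1 := h1.card_pos
    have p2 := h2.card_pos
    rw [hmul _ a1 a2 rfl hk hd, abs_mul, vs_union, Finset.card_union_of_disjoint hd, pow_add]
    have b1 := ih a1.card (by omega) a1 rfl h1.ne_empty (by omega)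
    have b2 := ih a2.card (by omega) a2 rfl h2.ne_empty (by omega)
    refine (mul_le_mul b1 b2 (abs_nonneg _) (by positivity)).trans ?_
    rw [mul_mul_mul_comm]
    gcongr
    rw [hcard, pow_add]
    push_cast
    gcongr
    · linarith [Nat.cast_nonneg (α := ℝ) a2.card]
    · linarith [Nat.cast_nonneg (α := ℝ) a1.card]
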